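/- arXiv:1407.3232 — 6 statements merged into one kernel-verified Lean document; each statement's English description precedes it below -/
import Mathlib

section
/- Let n ≥ 1, ε > 0, z = e^ε + e^{-ε}, and let p⁰ : Fin 2^n → ℝ be a computation-register state. Define p^{t+1} = PPA(p^t) for all t ∈ ℕ. Then for every iteration t ∈ ℕ and every index i with 0 ≤ i ≤ 2^n − 2 for which p^0_{i+1} > 0, one has p^t_i / p^t_{i+1} ≤ max{ e^{2ε}, p^0_i / p^0_{i+1} }. -/
open Real Filter

/-- The multiset of `2^(n+1)` joint probabilities `p i * e^±ε / z`,
sorted in decreasing order (as a list, largest first):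
entry `j` of this list is `λ_{j+1}` in the 1-indexed notation of the paper. -/
noncomputable def ppaSorted (n : ℕ) (ε : ℝ) (p : Fin (2^n) → ℝ) : List ℝ :=
  ((((Finset.univ : Finset (Fin (2^n))).val.map
      fun j => p j * Real.exp ε / (Real.exp ε + Real.exp (-ε))) +
    ((Finset.univ : Finset (Fin (2^n))).val.map
      fun j => p j * Real.exp (-ε) / (Real.exp ε + Real.exp (-ε)))).sort (· ≤ ·)).reverse

/-- One iteration of the Partner Pairing Algorithm with a reset qubit of
polarization ε: `p'_i = λ_{2i+1} + λ_{2i+2}` (1-indexed) of the sorted joint probabilities. -/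
noncomputable def PPA (n : ℕ) (ε : ℝ) (p : Fin (2^n) → ℝ) : Fin (2^n) → ℝ :=
  fun i => (ppaSorted n ε p).getD (2 * (i : ℕ)) 0 + (ppaSorted n ε p).getD (2 * (i : ℕ) + 1) 0

/-- A computation-register state: strictly positive entries, sorted in
decreasing order, summing to 1. -/
def IsCompState (n : ℕ) (p : Fin (2^n) → ℝ) : Prop :=
  (∀ i, 0 < p i) ∧ Antitone p ∧ ∑ i, p i = 1

/-- In a decreasing list, the `j`-th entry is at least `x` iff more than `j` entries are. -/
theorem List.le_getD_iff_lt_countP {l : List ℝ} (hl : l.Pairwise (· ≥ ·)) (x : ℝ) {j : ℕ}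
    (hj : j < l.length) : x ≤ l.getD j 0 ↔ j < l.countP (x ≤ ·) := by
  induction l generalizing j with
  | nil => simp at hj
  | cons a l ih =>
    rw [List.pairwise_cons] at hl
    by_cases hx : x ≤ a
    · cases j with
      | zero => simp [hx]
      | succ j =>
        have hj' : j < l.length := by simpa using hj
        simpa [hx] using ih hl.2 hj'
    · have h0 : l.countP (x ≤ ·) = 0 := by
        rw [List.countP_eq_zero]
        intro b hb
        have := hl.1 b hb
        simp only [decide_eq_true_eq]
        intro h
        exact hx (h.trans this)
      cases j with
      | zero => simp [hx, h0]
      | succ j =>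
        have hj' : j < l.length := by simpa using hj
        simpa [hx, h0] using ih hl.2 hj'

/-- For a decreasing family `f`, the value `f k` is at least `x` iff more than `k` values are. -/
theorem Antitone.le_iff_lt_countP {N : ℕ} {f : Fin N → ℝ} (hf : Antitone f) (x : ℝ) (k : Fin N) :
    x ≤ f k ↔ (k : ℕ) < ((Finset.univ : Finset (Fin N)).val.map f).countP (x ≤ ·) := by
  have hp : (List.ofFn f).Pairwise (· ≥ ·) := by
    rw [List.pairwise_ofFn]
    exact fun i j hij => hf hij.le
  have h := List.le_getD_iff_lt_countP hp x (j := k) (by simp)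
  rw [Fin.univ_val_map, Multiset.coe_countP, ← h]
  simp

theorem ppaSorted_pairwise (n : ℕ) (ε : ℝ) (p : Fin (2^n) → ℝ) :
    (ppaSorted n ε p).Pairwise (· ≥ ·) := by
  unfold ppaSorted
  rw [List.pairwise_reverse]
  exact Multiset.pairwise_sort _ _

theorem length_ppaSorted (n : ℕ) (ε : ℝ) (p : Fin (2^n) → ℝ) :
    (ppaSorted n ε p).length = 2 * 2^n := by
  simp [ppaSorted, two_mul]

theorem countP_ppaSorted (n : ℕ) (ε : ℝ) (p : Fin (2^n) → ℝ) (x : ℝ) :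
    (ppaSorted n ε p).countP (x ≤ ·) =
      ((Finset.univ : Finset (Fin (2^n))).val.map
        fun j => p j * Real.exp ε / (Real.exp ε + Real.exp (-ε))).countP (x ≤ ·) +
      ((Finset.univ : Finset (Fin (2^n))).val.map
        fun j => p j * Real.exp (-ε) / (Real.exp ε + Real.exp (-ε))).countP (x ≤ ·) := by
  unfold ppaSorted
  rw [List.countP_reverse, ← Multiset.countP_add, ← Multiset.coe_countP, Multiset.sort_eq]

theorem ppaSorted_getD_pos {n : ℕ} {ε : ℝ} {p : Fin (2^n) → ℝ} (hp : ∀ i, 0 < p i) {j : ℕ}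
    (hj : j < 2 * 2^n) : 0 < (ppaSorted n ε p).getD j 0 := by
  have hj' : j < (ppaSorted n ε p).length := by rwa [length_ppaSorted]
  rw [List.getD_eq_getElem _ _ hj']
  have hmem := List.getElem_mem hj'
  generalize (ppaSorted n ε p)[j] = v at hmem
  simp only [ppaSorted, List.mem_reverse, Multiset.mem_sort, Multiset.mem_add,
    Multiset.mem_map] at hmem
  rcases hmem with ⟨k, -, rfl⟩ | ⟨k, -, rfl⟩ <;>
  · have := hp k
    positivity

theorem ppaSorted_getD_anti {n : ℕ} {ε : ℝ} {p : Fin (2^n) → ℝ} {j k : ℕ} (hjk : j ≤ k)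
    (hk : k < 2 * 2^n) : (ppaSorted n ε p).getD k 0 ≤ (ppaSorted n ε p).getD j 0 := by
  have hk' : k < (ppaSorted n ε p).length := by rwa [length_ppaSorted]
  have h := ppaSorted_pairwise n ε p
  rw [List.le_getD_iff_lt_countP h _ (hjk.trans_lt hk')]
  exact hjk.trans_lt ((List.le_getD_iff_lt_countP h _ hk').1 le_rfl)

theorem PPA_pos {n : ℕ} {ε : ℝ} {p : Fin (2^n) → ℝ} (hp : ∀ i, 0 < p i) (i : Fin (2^n)) :
    0 < PPA n ε p i :=
  add_pos (ppaSorted_getD_pos hp (by omega)) (ppaSorted_getD_pos hp (by omega))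

theorem PPA_antitone (n : ℕ) (ε : ℝ) (p : Fin (2^n) → ℝ) : Antitone (PPA n ε p) := by
  intro i j hij
  have hij' : (i : ℕ) ≤ j := hij
  exact add_le_add (ppaSorted_getD_anti (by omega) (by omega))
    (ppaSorted_getD_anti (by omega) (by omega))

/-- A bound `M ≥ e^{2ε}` on the ratio of two neighbouring entries is preserved by `PPA`. -/
theorem PPA_le_mul_PPA {n : ℕ} {ε M : ℝ} {p : Fin (2^n) → ℝ} (hε : 0 < ε) (hp : ∀ i, 0 < p i)
    (hanti : Antitone p) (hM : Real.exp (2 * ε) ≤ M) {i k : Fin (2^n)}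
    (hik : (k : ℕ) = i + 1) (hr : p i ≤ M * p k) :
    PPA n ε p i ≤ M * PPA n ε p k := by
  have hM0 : 0 < M := (Real.exp_pos _).trans_le hM
  set z := Real.exp ε + Real.exp (-ε) with hz
  have hz0 : 0 < z := by positivity
  have hup : Antitone fun j => p j * Real.exp ε / z := by
    intro a b hab
    have := hanti hab
    dsimp only
    gcongr
  have hdown : Antitone fun j => p j * Real.exp (-ε) / z := by
    intro a b hab
    have := hanti hab
    dsimp only
    gcongr
  have hL : ∀ (x : ℝ) (j : ℕ), j < 2 * 2^n → (x ≤ (ppaSorted n ε p).getD j 0 ↔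
      j < ((Finset.univ : Finset (Fin (2^n))).val.map
          fun j => p j * Real.exp ε / z).countP (x ≤ ·) +
        ((Finset.univ : Finset (Fin (2^n))).val.map
          fun j => p j * Real.exp (-ε) / z).countP (x ≤ ·)) := by
    intro x j hj
    rw [List.le_getD_iff_lt_countP (ppaSorted_pairwise n ε p) x (by rwa [length_ppaSorted]),
      countP_ppaSorted]
  have hU := hup.le_iff_lt_countP
  have hD := hdown.le_iff_lt_countP
  have hdu : ∀ j, p j * Real.exp (-ε) / z ≤ p j * Real.exp ε / z := by
    intro j
    have := hp j
    have : Real.exp (-ε) ≤ Real.exp ε := Real.exp_le_exp.2 (by linarith)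
    gcongr
  have hud : ∀ j, p j * Real.exp ε / z ≤ M * (p j * Real.exp (-ε) / z) := by
    intro j
    have := hp j
    have he : Real.exp ε = Real.exp (2 * ε) * Real.exp (-ε) := by
      rw [← Real.exp_add]
      ring_nf
    calc p j * Real.exp ε / z = Real.exp (2 * ε) * (p j * Real.exp (-ε) / z) := by
          rw [he]
          ring
      _ ≤ _ := by gcongr
  have hrmul : ∀ c : ℝ, 0 < c → p i * c / z ≤ M * (p k * c / z) := by
    intro c hc
    calc p i * c / z ≤ M * p k * c / z := by gcongr
      _ = _ := by ring
  have h1 : (ppaSorted n ε p).getD (2 * (i : ℕ)) 0 ≤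
      M * (ppaSorted n ε p).getD (2 * (k : ℕ)) 0 := by
    set y := (ppaSorted n ε p).getD (2 * (i : ℕ)) 0
    have hy := (hL y (2 * (i : ℕ)) (by omega)).1 le_rfl
    rw [← div_le_iff₀' hM0, hL _ _ (by omega)]
    have hyi : y ≤ p i * Real.exp ε / z := by
      by_contra hc
      have hc' : ¬ y ≤ p i * Real.exp (-ε) / z := fun h => hc (h.trans (hdu _))
      rw [hU] at hc
      rw [hD] at hc'
      omega
    have hu := (hU (y / M) k).1
      ((div_le_iff₀' hM0).2 (hyi.trans (hrmul _ (Real.exp_pos _))))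
    have hd := (hD (y / M) i).1 ((div_le_iff₀' hM0).2 (hyi.trans (hud _)))
    omega
  have h2 : (ppaSorted n ε p).getD (2 * (i : ℕ) + 1) 0 ≤
      M * (ppaSorted n ε p).getD (2 * (k : ℕ) + 1) 0 := by
    set y := (ppaSorted n ε p).getD (2 * (i : ℕ) + 1) 0
    have hy := (hL y (2 * (i : ℕ) + 1) (by omega)).1 le_rfl
    rw [← div_le_iff₀' hM0, hL _ _ (by omega)]
    have hyd : y / M ≤ p k * Real.exp (-ε) / z := by
      rw [div_le_iff₀' hM0]
      by_contra hc
      have hcu : ¬ y ≤ p k * Real.exp ε / z := fun h => hc (h.trans (hud _))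
      have hcd : ¬ y ≤ p i * Real.exp (-ε) / z :=
        fun h => hc (h.trans (hrmul _ (Real.exp_pos _)))
      rw [hU] at hcu
      rw [hD] at hcd
      omega
    have hu := (hU _ _).1 (hyd.trans (hdu _))
    have hd := (hD _ _).1 hyd
    omega
  calc PPA n ε p i = (ppaSorted n ε p).getD (2 * (i : ℕ)) 0 +
        (ppaSorted n ε p).getD (2 * (i : ℕ) + 1) 0 := rfl
    _ ≤ M * (ppaSorted n ε p).getD (2 * (k : ℕ)) 0 +
        M * (ppaSorted n ε p).getD (2 * (k : ℕ) + 1) 0 := add_le_add h1 h2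
    _ = _ := (mul_add _ _ _).symm

/-- for every iteration `t` and every index `i` with `p⁰_{i+1} > 0`,
`p^t_i / p^t_{i+1} ≤ max{e^{2ε}, p⁰_i / p⁰_{i+1}}`. -/
theorem ppa_ratio_bound (n : ℕ) (hn : 1 ≤ n) (ε : ℝ) (hε : 0 < ε)
    (p : ℕ → Fin (2^n) → ℝ) (h0 : IsCompState n (p 0))
    (hstep : ∀ t, p (t + 1) = PPA n ε (p t)) :
    ∀ t : ℕ, ∀ i : ℕ, ∀ hi : i + 1 < 2^n,
      0 < p 0 ⟨i + 1, hi⟩ →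
      p t ⟨i, by omega⟩ / p t ⟨i + 1, hi⟩ ≤
        max (Real.exp (2 * ε)) (p 0 ⟨i, by omega⟩ / p 0 ⟨i + 1, hi⟩) := by
  intro t i hi _
  have hstate : ∀ t, (∀ j, 0 < p t j) ∧ Antitone (p t) := by
    intro t
    induction t with
    | zero => exact ⟨h0.1, h0.2.1⟩
    | succ t ih =>
      rw [hstep t]
      exact ⟨PPA_pos ih.1, PPA_antitone n ε (p t)⟩
  rw [div_le_iff₀ ((hstate t).1 _)]
  induction t with
  | zero => exact (div_le_iff₀ (h0.1 _)).1 (le_max_right _ _)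
  | succ t ih =>
    rw [hstep t]
    exact PPA_le_mul_PPA hε (hstate t).1 (hstate t).2 (le_max_left _ _) rfl ih
end

section
/- Let n ≥ 1, let a : Fin k → ℝ with a_1 ≥ a_2 ≥ ⋯ ≥ a_k > 0 and Σ a_l = 1, and let p⁰ : Fin 2^n → ℝ be a computation-register state. Define p^{t+1} = PPA_a(p^t) for all t ∈ ℕ. Then for every iteration t and every index i with 0 ≤ i ≤ 2^n − 2, one has p^t_i / p^t_{i+1} ≤ max{ p^0_i / p^0_{i+1}, a_1 / a_k }. -/
open Real Filter

/-- One iteration of the Partner Pairing Algorithm with a reset qudit of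
distribution `a : Fin k → ℝ`: the `k·2^n` joint probabilities `p i * a l` are
sorted decreasingly as `λ_1 ≥ λ_2 ≥ ⋯` and `p'_i = Σ_{j=1}^{k} λ_{ik+j}`. -/
noncomputable def PPAq (n k : ℕ) (a : Fin k → ℝ) (p : Fin (2^n) → ℝ) : Fin (2^n) → ℝ :=
  fun i =>
    let l := (((Finset.univ : Finset (Fin (2^n) × Fin k)).val.map
        fun x => p x.1 * a x.2).sort (· ≤ ·)).reverse
    ∑ j : Fin k, l.getD ((i : ℕ) * k + (j : ℕ)) 0

/-- The values of `f` in decreasing order. -/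
noncomputable def decreasingValues {ι : Type*} [Fintype ι] (f : ι → ℝ) : List ℝ :=
  (((Finset.univ : Finset ι).val.map f).sort (· ≤ ·)).reverse

section decreasingValues

variable {ι : Type*} [Fintype ι] (f : ι → ℝ)

lemma pairwise_decreasingValues : (decreasingValues f).Pairwise (· ≥ ·) := by
  unfold decreasingValues
  rw [List.pairwise_reverse]
  exact Multiset.pairwise_sort _ _

lemma length_decreasingValues : (decreasingValues f).length = Fintype.card ι := by
  simp [decreasingValues]

lemma countP_decreasingValues (P : ℝ → Prop) [DecidablePred P] :
    (decreasingValues f).countP (fun x => decide (P x)) =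
      (Finset.univ.filter fun x => P (f x)).card := by
  unfold decreasingValues
  rw [List.countP_reverse, ← Multiset.coe_countP, Multiset.sort_eq, Multiset.countP_map]
  rfl

lemma exists_eq_of_mem_decreasingValues {x : ℝ} (hx : x ∈ decreasingValues f) :
    ∃ i, f i = x := by
  simpa [decreasingValues] using hx

lemma getElem_decreasingValues_le_of_le {s t : ℕ} (hst : s ≤ t)
    (ht : t < (decreasingValues f).length) :
    (decreasingValues f)[t] ≤ (decreasingValues f)[s] := by
  rcases hst.eq_or_lt with rfl | h
  · rfl
  · exact List.pairwise_iff_getElem.1 (pairwise_decreasingValues f) s t (by omega) ht h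

variable {f} {M : ℕ} (e : ι ≃ Fin M)

lemma card_filter_equiv_lt {t : ℕ} (ht : t ≤ M) :
    (Finset.univ.filter fun x => (e x : ℕ) < t).card = t := by
  have h : (Finset.univ.filter fun x => (e x : ℕ) < t).map e.toEmbedding =
      Finset.univ.filter fun y : Fin M => (y : ℕ) < t := by
    ext y
    simp only [Finset.mem_map_equiv, Finset.mem_filter, Finset.mem_univ, true_and,
      Equiv.apply_symm_apply]
  rw [← Finset.card_map e.toEmbedding, h, Fin.card_filter_val_lt, min_eq_right ht]

lemma getElem_decreasingValues_le {t : ℕ} (ht : t < (decreasingValues f).length) {c : ℝ}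
    (h : ∀ x, t ≤ (e x : ℕ) → f x ≤ c) : (decreasingValues f)[t] ≤ c := by
  have htM : t < M := by
    rwa [length_decreasingValues, Fintype.card_congr e, Fintype.card_fin] at ht
  by_contra! hc
  have hle : (Finset.univ.filter fun x => c < f x).card ≤ t := by
    rw [← card_filter_equiv_lt e htM.le]
    refine Finset.card_le_card fun x hx => ?_
    simp only [Finset.mem_filter, Finset.mem_univ, true_and] at hx ⊢
    by_contra! hx'
    exact (h x hx').not_gt hx
  rw [← countP_decreasingValues f (c < ·)] at hle
  have hsub := (List.take_sublist (t + 1) (decreasingValues f)).countP_le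
    (p := fun x => decide (c < x))
  have hall : ((decreasingValues f).take (t + 1)).countP (fun x => decide (c < x)) =
      ((decreasingValues f).take (t + 1)).length := by
    rw [List.countP_eq_length]
    intro x hx
    obtain ⟨s, hs, rfl⟩ := List.mem_take_iff_getElem.1 hx
    simpa using hc.trans_le (getElem_decreasingValues_le_of_le f (by omega) ht)
  rw [hall, List.length_take] at hsub
  omega

lemma le_getElem_decreasingValues {t : ℕ} (ht : t < (decreasingValues f).length) {c : ℝ}
    (h : ∀ x, (e x : ℕ) ≤ t → c ≤ f x) : c ≤ (decreasingValues f)[t] := by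
  have htM : t < M := by
    rwa [length_decreasingValues, Fintype.card_congr e, Fintype.card_fin] at ht
  by_contra! hc
  have hle : t + 1 ≤ (Finset.univ.filter fun x => c ≤ f x).card := by
    rw [← card_filter_equiv_lt e (t := t + 1) (by omega)]
    refine Finset.card_le_card fun x hx => ?_
    simp only [Finset.mem_filter, Finset.mem_univ, true_and] at hx ⊢
    exact h x (by omega)
  rw [← countP_decreasingValues f (c ≤ ·), ← List.take_append_drop t (decreasingValues f),
    List.countP_append] at hle
  have hzero : ((decreasingValues f).drop t).countP (fun x => decide (c ≤ x)) = 0 := by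
    rw [List.countP_eq_zero]
    intro x hx
    obtain ⟨s, hs, rfl⟩ := List.mem_drop_iff_getElem.1 hx
    simpa using (getElem_decreasingValues_le_of_le f (Nat.le_add_right t s) (by omega)).trans_lt hc
  have hlen := List.countP_le_length (p := fun x => decide (c ≤ x))
    (l := (decreasingValues f).take t)
  rw [List.length_take] at hlen
  omega

end decreasingValues

section PPAq

variable {n k : ℕ} {a : Fin k → ℝ} {p : Fin (2 ^ n) → ℝ}

lemma length_decreasingValues_prod :
    (decreasingValues fun x : Fin (2 ^ n) × Fin k => p x.1 * a x.2).length = 2 ^ n * k := by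
  simp [length_decreasingValues]

lemma mul_add_lt_mul {i j N k : ℕ} (hi : i < N) (hj : j < k) : i * k + j < N * k := by
  nlinarith [Nat.mul_le_mul_right k (Nat.succ_le_of_lt hi)]

lemma PPAq_apply (i : Fin (2 ^ n)) :
    PPAq n k a p i = ∑ j : Fin k,
      (decreasingValues fun x : Fin (2 ^ n) × Fin k => p x.1 * a x.2)[(i : ℕ) * k + j]'(by
        rw [length_decreasingValues_prod]; exact mul_add_lt_mul i.2 j.2) :=
  Finset.sum_congr rfl fun _ _ => List.getD_eq_getElem _ _ _

lemma PPAq_pos (hk : 0 < k) (ha : ∀ l, 0 < a l) (hp : ∀ i, 0 < p i) (i : Fin (2 ^ n)) :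
    0 < PPAq n k a p i := by
  rw [PPAq_apply]
  refine Finset.sum_pos (fun j _ => ?_) ⟨⟨0, hk⟩, Finset.mem_univ _⟩
  obtain ⟨x, hx⟩ := exists_eq_of_mem_decreasingValues _ (List.getElem_mem (
    (by rw [length_decreasingValues_prod]; exact mul_add_lt_mul i.2 j.2) :
    (i : ℕ) * k + j < (decreasingValues fun x : Fin (2 ^ n) × Fin k => p x.1 * a x.2).length))
  rw [← hx]
  exact mul_pos (hp _) (ha _)

lemma antitone_PPAq : Antitone (PPAq n k a p) := by
  intro i i' h
  rw [PPAq_apply, PPAq_apply]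
  refine Finset.sum_le_sum fun _ _ => getElem_decreasingValues_le_of_le _ ?_ _
  have : (i : ℕ) * k ≤ i' * k := Nat.mul_le_mul_right k h
  omega

/-- A single iteration raises the ratio of two consecutive entries at most to the larger of its
previous value and `a_1 / a_k`. -/
lemma PPAq_le_mul_PPAq {a : Fin (k + 1) → ℝ} (ha : Antitone a) (hapos : ∀ l, 0 < a l)
    (hp : Antitone p) (hpos : ∀ i, 0 < p i) {C : ℝ} {i i' : Fin (2 ^ n)}
    (hi : (i' : ℕ) = i + 1) (hpC : p i ≤ C * p i') (haC : a 0 ≤ C * a (Fin.last k)) :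
    PPAq n (k + 1) a p i ≤ C * PPAq n (k + 1) a p i' := by
  have hC : 0 < C := pos_of_mul_pos_left ((hapos 0).trans_le haC) (hapos _).le
  rw [PPAq_apply, PPAq_apply, Finset.mul_sum]
  refine Finset.sum_le_sum fun j _ => ?_
  have hx : (decreasingValues fun x : Fin (2 ^ n) × Fin (k + 1) => p x.1 * a x.2)[
      (i : ℕ) * (k + 1) + j]'(by
        rw [length_decreasingValues_prod]; exact mul_add_lt_mul i.2 j.2) ≤
      max (p i * a j) (p i' * a 0) := by
    refine getElem_decreasingValues_le finProdFinEquiv _ ?_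
    rintro ⟨m, l⟩ h
    simp only [finProdFinEquiv_apply_val] at h
    rcases lt_trichotomy (m : ℕ) i with hm | hm | hm
    · have := mul_add_lt_mul hm l.2
      rw [mul_comm] at h
      nlinarith
    · obtain rfl : m = i := Fin.ext hm
      refine le_max_of_le_left (mul_le_mul_of_nonneg_left (ha ?_) (hpos _).le)
      rw [Fin.le_def]
      nlinarith
    · refine le_max_of_le_right (mul_le_mul (hp ?_) (ha (Fin.zero_le _)) (hapos _).le (hpos _).le)
      change (i' : ℕ) ≤ m
      omega
  have hy : min (p i' * a j) (p i * a (Fin.last k)) ≤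
      (decreasingValues fun x : Fin (2 ^ n) × Fin (k + 1) => p x.1 * a x.2)[
      (i' : ℕ) * (k + 1) + j]'(by
        rw [length_decreasingValues_prod]; exact mul_add_lt_mul i'.2 j.2) := by
    refine le_getElem_decreasingValues finProdFinEquiv _ ?_
    rintro ⟨m, l⟩ h
    simp only [finProdFinEquiv_apply_val] at h
    rcases lt_trichotomy (m : ℕ) i' with hm | hm | hm
    · refine min_le_of_right_le (mul_le_mul (hp ?_) (ha (Fin.le_last _)) (hapos _).le (hpos _).le)
      change (m : ℕ) ≤ i
      omega
    · obtain rfl : m = i' := Fin.ext hm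
      refine min_le_of_left_le (mul_le_mul_of_nonneg_left (ha ?_) (hpos _).le)
      rw [Fin.le_def]
      nlinarith
    · have := mul_add_lt_mul hm j.2
      nlinarith
  refine hx.trans (le_trans ?_ (mul_le_mul_of_nonneg_left hy hC.le))
  have hii' : p i' ≤ p i := hp (by rw [Fin.le_def]; omega)
  have haj : a j ≤ a 0 := ha (Fin.zero_le _)
  have haj' : a (Fin.last k) ≤ a j := ha (Fin.le_last _)
  have hajC : a 0 ≤ C * a j := haC.trans (mul_le_mul_of_nonneg_left haj' hC.le)
  rw [mul_min_of_nonneg _ _ hC.le]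
  refine max_le (le_min ?_ ?_) (le_min ?_ ?_)
  · nlinarith [hapos j]
  · nlinarith [hpos i]
  · nlinarith [hpos i']
  · nlinarith [hpos i', mul_le_mul hii' haC (hapos 0).le (hpos i).le]

end PPAq

/-- Theorem S2 of the paper: for PPA with a reset qudit of sorted
distribution `a_1 ≥ ⋯ ≥ a_k > 0`, for every iteration `t` and every index `i`,
`p^t_i / p^t_{i+1} ≤ max{p⁰_i / p⁰_{i+1}, a_1 / a_k}`.
(Here the qudit has `k+1` levels, so `a 0` is `a_1` and `a (Fin.last k)` is `a_k`.) -/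
theorem ppaq_ratio_bound (n k : ℕ) (hn : 1 ≤ n)
    (a : Fin (k + 1) → ℝ) (ha : Antitone a) (hapos : ∀ l, 0 < a l)
    (hasum : ∑ l, a l = 1)
    (p : ℕ → Fin (2^n) → ℝ) (h0 : IsCompState n (p 0))
    (hstep : ∀ t, p (t + 1) = PPAq n (k + 1) a (p t)) :
    ∀ t : ℕ, ∀ i : ℕ, ∀ hi : i + 1 < 2^n,
      p t ⟨i, by omega⟩ / p t ⟨i + 1, hi⟩ ≤
        max (p 0 ⟨i, by omega⟩ / p 0 ⟨i + 1, hi⟩) (a 0 / a (Fin.last k)) := by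
  have hstate : ∀ t, (∀ i, 0 < p t i) ∧ Antitone (p t) := by
    intro t
    induction t with
    | zero => exact ⟨h0.1, h0.2.1⟩
    | succ t ih =>
      rw [hstep]
      exact ⟨PPAq_pos k.succ_pos hapos ih.1, antitone_PPAq⟩
  intro t i hi
  rw [div_le_iff₀ ((hstate t).1 _)]
  induction t with
  | zero =>
    rw [← div_le_iff₀ (h0.1 _)]
    exact le_max_left _ _
  | succ t ih =>
    rw [hstep]
    refine PPAq_le_mul_PPAq ha hapos (hstate t).2 (hstate t).1 rfl ih ?_
    rw [← div_le_iff₀ (hapos _)]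
    exact le_max_right _ _
end

section
/- (Crossing from above.) Let q_0 ≥ q_1 ≥ ⋯ ≥ q_i > 0 be real numbers and let a_1 ≥ a_2 ≥ ⋯ ≥ a_k > 0. Let M be the multiset { q_m · a_l : 0 ≤ m ≤ i, 1 ≤ l ≤ k }, and for j = 1, …, k let λ_j denote the (k − j + 1)-th smallest element of M (so λ_1 ≥ λ_2 ≥ ⋯ ≥ λ_k are the k smallest elements of M in decreasing order). Then for every j = 1, …, k one has q_i · a_k ≤ λ_j ≤ q_i · a_j; in particular λ_k = q_i · a_k. -/
open Real Filter

/-- In a nondecreasing list with more than `n` entries at most `c`, the entry at index `n` is at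
most `c`. -/
theorem List.getD_le_of_lt_countP {α : Type*} [LinearOrder α] (c d : α) (l : List α)
    (hs : l.Pairwise (· ≤ ·)) (n : ℕ) (hn : n < l.countP (· ≤ c)) : l.getD n d ≤ c := by
  induction l generalizing n with
  | nil => simp at hn
  | cons x xs ih =>
    rw [List.pairwise_cons] at hs
    cases n with
    | zero =>
      obtain ⟨y, hy, hyc⟩ := List.countP_pos_iff.1 hn
      have hyc : y ≤ c := by simpa using hyc
      rcases List.mem_cons.1 hy with rfl | hy
      · simpa using hyc
      · simpa using (hs.1 y hy).trans hyc
    | succ n =>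
      rw [List.getD_cons_succ]
      refine ih hs.2 n ?_
      rw [List.countP_cons] at hn
      split_ifs at hn <;> omega

/-- Crossing from above: let `q_0 ≥ ⋯ ≥ q_i > 0` (here `q : Fin (N+1) → ℝ`
with `q_i = q (Fin.last N)`) and `a_1 ≥ ⋯ ≥ a_k > 0` (here `a : Fin (k+1) → ℝ`, so the
qudit has `k+1` levels, `a_1 = a 0` and `a_k = a (Fin.last k)`). Let `M` be the multiset
`{q_m · a_l}` and for `j = 1, …, k` let `λ_j` be the `(k − j + 1)`-th smallest element of
`M`; with `l` the increasingly sorted list of `M` and 0-indexed `j : Fin (k+1)`, this is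
`l.getD (k - j) 0`. Then `q_i · a_k ≤ λ_j ≤ q_i · a_j`, and `λ_k = q_i · a_k`. -/
theorem crossing_from_above (N k : ℕ) (q : Fin (N + 1) → ℝ) (a : Fin (k + 1) → ℝ)
    (hq : Antitone q) (hqpos : ∀ m, 0 < q m)
    (ha : Antitone a) (hapos : ∀ l, 0 < a l)
    (l : List ℝ)
    (hl : l = ((Finset.univ : Finset (Fin (N + 1) × Fin (k + 1))).val.map
        (fun x => q x.1 * a x.2)).sort (· ≤ ·)) :
    (∀ j : Fin (k + 1),
      q (Fin.last N) * a (Fin.last k) ≤ l.getD (k - (j : ℕ)) 0 ∧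
      l.getD (k - (j : ℕ)) 0 ≤ q (Fin.last N) * a j) ∧
    l.getD 0 0 = q (Fin.last N) * a (Fin.last k) := by
  have hsorted : l.Pairwise (· ≤ ·) := hl ▸ Multiset.pairwise_sort _ _
  have hcoe : (l : Multiset ℝ) = (Finset.univ : Finset (Fin (N + 1) × Fin (k + 1))).val.map
      (fun x => q x.1 * a x.2) := by rw [hl, Multiset.sort_eq]
  have hcount (j : Fin (k + 1)) :
      k - (j : ℕ) < l.countP (· ≤ q (Fin.last N) * a j) := by
    have hcard : l.countP (· ≤ q (Fin.last N) * a j) =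
        (Finset.univ.filter fun x : Fin (N + 1) × Fin (k + 1) =>
          q x.1 * a x.2 ≤ q (Fin.last N) * a j).card := by
      rw [← Multiset.coe_countP, hcoe, Multiset.countP_map]
      rfl
    have hsub : ({Fin.last N} ×ˢ Finset.Ici j) ⊆
        Finset.univ.filter fun x : Fin (N + 1) × Fin (k + 1) =>
          q x.1 * a x.2 ≤ q (Fin.last N) * a j := by
      rintro ⟨m, i⟩ hx
      simp only [Finset.mem_product, Finset.mem_singleton, Finset.mem_Ici] at hx
      obtain ⟨rfl, hji⟩ := hx
      simpa using mul_le_mul_of_nonneg_left (ha hji) (hqpos _).le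
    have hle := Finset.card_le_card hsub
    rw [Finset.card_product, Finset.card_singleton, Fin.card_Ici] at hle
    omega
  have hupper (j : Fin (k + 1)) : l.getD (k - (j : ℕ)) 0 ≤ q (Fin.last N) * a j :=
    l.getD_le_of_lt_countP _ 0 hsorted _ (hcount j)
  have hlower (j : Fin (k + 1)) :
      q (Fin.last N) * a (Fin.last k) ≤ l.getD (k - (j : ℕ)) 0 := by
    have hlt : k - (j : ℕ) < l.length := (hcount j).trans_le List.countP_le_length
    rw [List.getD_eq_getElem _ _ hlt]
    have hmem : l[k - (j : ℕ)] ∈ (l : Multiset ℝ) := List.getElem_mem hlt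
    rw [hcoe] at hmem
    obtain ⟨x, -, hx⟩ := Multiset.mem_map.1 hmem
    rw [← hx]
    exact mul_le_mul (hq (Fin.le_last _)) (ha (Fin.le_last _)) (hapos _).le (hqpos _).le
  refine ⟨fun j => ⟨hlower j, hupper j⟩, ?_⟩
  simpa using le_antisymm (hupper (Fin.last k)) (hlower (Fin.last k))
end

section
/- Let ε > 0 and z = e^ε + e^{-ε}, and let p be a computation-register state on Fin 2^n. If p_i · e^{-ε} ≥ p_{i+1} · e^ε for every index i with 0 ≤ i ≤ 2^n − 2 (i.e., the state p ⊗ (e^ε/z, e^{-ε}/z) is already sorted in decreasing order), then p is a fixed point of the PPA iteration: PPA(p) = p. -/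
open Real Filter

/-- The sequence `F 0, G 0, F 1, G 1, …`. -/
def alternate {α : Type*} (F G : ℕ → α) (k : ℕ) : α :=
  if k % 2 = 0 then F (k / 2) else G (k / 2)

theorem alternate_two_mul {α : Type*} (F G : ℕ → α) (k : ℕ) :
    alternate F G (2 * k) = F k := by
  simp [alternate]

theorem alternate_two_mul_add_one {α : Type*} (F G : ℕ → α) (k : ℕ) :
    alternate F G (2 * k + 1) = G k := by
  have h₁ : (2 * k + 1) % 2 = 1 := by omega
  have h₂ : (2 * k + 1) / 2 = k := by omega
  simp [alternate, h₁, h₂]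

theorem antitone_alternate {α : Type*} [Preorder α] {F G : ℕ → α}
    (hGF : ∀ k, G k ≤ F k) (hFG : ∀ k, F (k + 1) ≤ G k) : Antitone (alternate F G) := by
  refine antitone_nat_of_succ_le fun k => ?_
  obtain ⟨j, rfl | rfl⟩ := Nat.even_or_odd' k
  · rw [alternate_two_mul, alternate_two_mul_add_one]
    exact hGF j
  · rw [show 2 * j + 1 + 1 = 2 * (j + 1) by ring, alternate_two_mul, alternate_two_mul_add_one]
    exact hFG j

theorem coe_map_alternate_range {α : Type*} (F G : ℕ → α) (m : ℕ) :
    (((List.range (2 * m)).map (alternate F G) : List α) : Multiset α) =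
      (Multiset.range m).map F + (Multiset.range m).map G := by
  induction m with
  | zero => simp
  | succ m ih =>
    rw [show 2 * (m + 1) = 2 * m + 1 + 1 by ring, List.range_succ, List.range_succ,
      Multiset.range_succ, Multiset.map_cons, Multiset.map_cons, List.map_append, List.map_append,
      ← Multiset.coe_add, ← Multiset.coe_add, ih]
    simp only [List.map_cons, List.map_nil, alternate_two_mul, alternate_two_mul_add_one,
      Multiset.coe_singleton, ← Multiset.singleton_add]
    abel

theorem univ_val_map_fin {α : Type*} (m : ℕ) (F : ℕ → α) :
    (Finset.univ : Finset (Fin m)).val.map (fun j : Fin m => F j) = (Multiset.range m).map F := by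
  rw [Fin.univ_val_map, List.ofFn_eq_map, ← Multiset.coe_range, Multiset.map_coe,
    ← List.map_coe_finRange_eq_range, List.map_map]
  rfl

theorem reverse_sort_coe_of_pairwise_ge {α : Type*} [LinearOrder α] {l : List α}
    (hl : l.Pairwise (· ≥ ·)) :
    ((l : Multiset α).sort (· ≤ ·)).reverse = l := by
  refine List.Perm.eq_of_pairwise' (r := (· ≥ ·)) ?_ hl ?_
  · rw [List.pairwise_reverse]
    exact Multiset.pairwise_sort _ _
  · exact (List.reverse_perm _).trans (Multiset.coe_eq_coe.1 (Multiset.sort_eq _ _))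

theorem ppaSorted_eq_map_alternate (n : ℕ) (ε : ℝ) (p : Fin (2^n) → ℝ) (P : ℕ → ℝ)
    (hpP : ∀ i, p i = P i) (hε : 0 ≤ ε) (hP : ∀ k, 0 ≤ P k)
    (hsorted : ∀ k, P (k + 1) * Real.exp ε ≤ P k * Real.exp (-ε)) :
    ppaSorted n ε p = (List.range (2 * 2^n)).map
      (alternate (fun k => P k * Real.exp ε / (Real.exp ε + Real.exp (-ε)))
        (fun k => P k * Real.exp (-ε) / (Real.exp ε + Real.exp (-ε)))) := by
  have hz : 0 ≤ Real.exp ε + Real.exp (-ε) := by positivity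
  have hanti : Antitone (alternate (fun k => P k * Real.exp ε / (Real.exp ε + Real.exp (-ε)))
      (fun k => P k * Real.exp (-ε) / (Real.exp ε + Real.exp (-ε)))) := by
    refine antitone_alternate (fun k => ?_) fun k => div_le_div_of_nonneg_right (hsorted k) hz
    refine div_le_div_of_nonneg_right (mul_le_mul_of_nonneg_left ?_ (hP k)) hz
    exact Real.exp_le_exp.2 (by linarith)
  unfold ppaSorted
  simp only [hpP]
  rw [univ_val_map_fin _ fun k => P k * Real.exp ε / (Real.exp ε + Real.exp (-ε)),
    univ_val_map_fin _ fun k => P k * Real.exp (-ε) / (Real.exp ε + Real.exp (-ε)),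
    ← coe_map_alternate_range]
  refine reverse_sort_coe_of_pairwise_ge (List.pairwise_map.2 ?_)
  exact List.pairwise_lt_range.imp fun h => hanti h.le

/-- if `p_i e^{-ε} ≥ p_{i+1} e^{ε}` for all `i` (the full state
`p ⊗ ρ_R` is already sorted), then `p` is a fixed point of the PPA iteration. -/
theorem ppa_fixed_point_of_sorted (n : ℕ) (hn : 1 ≤ n) (ε : ℝ) (hε : 0 < ε)
    (p : Fin (2^n) → ℝ) (hp : IsCompState n p)
    (hsorted : ∀ i : ℕ, ∀ hi : i + 1 < 2^n,
      p ⟨i + 1, hi⟩ * Real.exp ε ≤ p ⟨i, by omega⟩ * Real.exp (-ε)) :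
    PPA n ε p = p := by
  obtain ⟨hpos, -, -⟩ := hp
  let P : ℕ → ℝ := fun k => if h : k < 2^n then p ⟨k, h⟩ else 0
  have hpP : ∀ i, p i = P i := fun i => by simp [P]
  have hP : ∀ k, 0 ≤ P k := fun k => by
    by_cases h : k < 2^n
    · simpa [P, h] using (hpos _).le
    · simp [P, h]
  have hPsorted : ∀ k, P (k + 1) * Real.exp ε ≤ P k * Real.exp (-ε) := fun k => by
    by_cases h : k + 1 < 2^n
    · simpa [P, h, (Nat.lt_succ_self k).trans h] using hsorted k h
    · have h₀ : P (k + 1) = 0 := by simp [P, h]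
      rw [h₀, zero_mul]
      exact mul_nonneg (hP k) (Real.exp_pos _).le
  funext i
  have hi := i.isLt
  have h₁ : 2 * (i : ℕ) + 1 < 2 * 2^n := by omega
  have hz : Real.exp ε + Real.exp (-ε) ≠ 0 := by positivity
  unfold PPA
  rw [ppaSorted_eq_map_alternate n ε p P hpP hε.le hP hPsorted,
    List.getD_eq_getElem _ _ (by simp), List.getD_eq_getElem _ _ (by simpa using h₁)]
  simp only [List.getElem_map, List.getElem_range, alternate_two_mul, alternate_two_mul_add_one]
  rw [hpP i, ← add_div, ← mul_add, mul_div_cancel_right₀ _ hz]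
end

section
/- Let ε > 0, n ≥ 1, z = e^ε + e^{-ε}, and p^∞_0 = (e^{-2ε} − 1)/((e^{-2ε})^{2^n} − 1). Then the largest eigenvalue of the asymptotic state of n computation qubits plus the reset qubit, λ_1^∞ = (e^ε / z) · p^∞_0, satisfies the Schulman et al. bound λ_1^∞ ≤ e^{2^n ε} / 2^n. -/
open Real Filter

lemma nat_mul_sinh_le_sinh_nat_mul (k : ℕ) {x : ℝ} (hx : 0 ≤ x) :
    k * Real.sinh x ≤ Real.sinh (k * x) := by
  induction k with
  | zero => simp
  | succ k ih =>
    have hs : 0 ≤ Real.sinh x := Real.sinh_nonneg_iff.2 hx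
    have hks : 0 ≤ Real.sinh (k * x) := Real.sinh_nonneg_iff.2 (by positivity)
    have hle : Real.sinh (k * x) ≤ Real.sinh (k * x) * Real.cosh x :=
      le_mul_of_one_le_right hks (Real.one_le_cosh x)
    have hle' : Real.sinh x ≤ Real.cosh (k * x) * Real.sinh x :=
      le_mul_of_one_le_left hs (Real.one_le_cosh _)
    push_cast
    rw [add_mul, one_mul, add_mul, one_mul, Real.sinh_add]
    linarith

/-- the largest eigenvalue of the asymptotic state,
`λ_1^∞ = (e^ε / z) · p^∞_0` with `p^∞_0 = (e^{-2ε} − 1)/((e^{-2ε})^{2^n} − 1)`,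
satisfies the Schulman et al. bound `λ_1^∞ ≤ e^{2^n ε}/2^n`. -/
theorem schulman_bound (n : ℕ) (hn : 1 ≤ n) (ε : ℝ) (hε : 0 < ε) :
    (Real.exp ε / (Real.exp ε + Real.exp (-ε))) *
      ((Real.exp (-(2 * ε)) - 1) / ((Real.exp (-(2 * ε))) ^ (2^n) - 1)) ≤
      Real.exp ((2^n : ℝ) * ε) / (2^n : ℝ) := by
  have hsinh := nat_mul_sinh_le_sinh_nat_mul (2 ^ n) hε.le
  rw [Real.sinh_eq, Real.sinh_eq] at hsinh
  push_cast at hsinh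
  have hN : (0 : ℝ) < 2 ^ n := by positivity
  have hq : Real.exp (-(2 * ε)) = Real.exp (-ε) * Real.exp (-ε) := by
    rw [← Real.exp_add]; ring_nf
  have hqN : Real.exp (-(2 * ε)) ^ (2 ^ n) =
      Real.exp (-(2 ^ n * ε)) * Real.exp (-(2 ^ n * ε)) := by
    rw [← Real.exp_nat_mul, ← Real.exp_add]; push_cast; ring_nf
  have hab : Real.exp ε * Real.exp (-ε) = 1 := by rw [← Real.exp_add]; simp
  have hAB : Real.exp (2 ^ n * ε) * Real.exp (-(2 ^ n * ε)) = 1 := by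
    rw [← Real.exp_add]; simp
  have ha : 1 ≤ Real.exp ε := Real.one_le_exp hε.le
  have hb := Real.exp_pos (-ε)
  have hB := Real.exp_pos (-(2 ^ n * ε))
  have hB1 : Real.exp (-(2 ^ n * ε)) < 1 := Real.exp_lt_one_iff.2 (by simp [hε])
  have hA1 : 1 ≤ Real.exp (2 ^ n * ε) := Real.one_le_exp (by positivity)
  rw [hqN, hq]
  generalize Real.exp ε = a at *
  generalize Real.exp (-ε) = b at *
  generalize Real.exp (2 ^ n * ε) = A at *
  generalize Real.exp (-(2 ^ n * ε)) = B at *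
  generalize (2 : ℝ) ^ n = N at *
  have hBB : 0 < 1 - B * B := by nlinarith
  have hnum : a * (1 - b * b) = a - b := by linear_combination (-b) * hab
  have hden : A * (1 - B * B) = A - B := by linear_combination (-B) * hAB
  rw [← neg_div_neg_eq (b * b - 1), neg_sub, neg_sub, div_mul_div_comm, hnum,
    div_le_div_iff₀ (by positivity) hN]
  calc (a - b) * N ≤ A - B := by linarith
    _ ≤ (a + b) * (A - B) := le_mul_of_one_le_left (by linarith) (by linarith)
    _ = A * ((a + b) * (1 - B * B)) := by rw [← hden]; ring
end

section
/- Let n ≥ 1, let a : Fin k → ℝ be a reset qudit distribution with a_1 ≥ ⋯ ≥ a_k > 0 and Σ a_l = 1, and let p⁰ be a computation-register state on Fin 2^n satisfying p^0_i / p^0_{i+1} ≤ a_1/a_k for all i. Define p^{t+1} = PPA_a(p^t). Then for every index i the limit p^∞_i = lim_{t→∞} p^t_i exists and satisfies p^∞_{i+1} = (a_k / a_1) · p^∞_i for all i; i.e., p^∞_i = (a_k/a_1)^i · p^∞_0. -/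
open Real Filter

/-- The sum of the first `m` entries of a vector indexed by `Fin N`. -/
noncomputable def partialSum {N : ℕ} (p : Fin N → ℝ) (m : ℕ) : ℝ :=
  ∑ i ∈ Finset.range m, if h : i < N then p ⟨i, h⟩ else 0

lemma partialSum_succ {N : ℕ} (p : Fin N → ℝ) (i : Fin N) :
    partialSum p (i + 1) = partialSum p i + p i := by
  simp [partialSum, Finset.sum_range_succ]

lemma partialSum_self {N : ℕ} (p : Fin N → ℝ) : partialSum p N = ∑ i, p i := by
  rw [partialSum, Finset.sum_range]
  simp

lemma partialSum_mono {N : ℕ} {p : Fin N → ℝ} (hp : ∀ i, 0 ≤ p i) : Monotone (partialSum p) := by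
  intro m m' h
  refine Finset.sum_le_sum_of_subset_of_nonneg (Finset.range_mono h) fun i _ _ => ?_
  split_ifs
  exacts [hp _, le_rfl]

lemma sum_le_sum_range_card {u : ℕ → ℝ} (hu : Antitone u) (s : Finset ℕ) :
    ∑ j ∈ s, u j ≤ ∑ j ∈ Finset.range s.card, u j := by
  set c := s.card with hc
  have hcard : (s \ Finset.range c).card = (Finset.range c \ s).card := by
    apply Finset.card_sdiff_comm
    simp [hc]
  rw [← Finset.sum_inter_add_sum_sdiff s (Finset.range c) u,
    ← Finset.sum_inter_add_sum_sdiff (Finset.range c) s u, Finset.inter_comm]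
  have h1 : ∑ j ∈ s \ Finset.range c, u j ≤ (s \ Finset.range c).card • u c :=
    Finset.sum_le_card_nsmul _ _ _ fun j hj => hu (by simpa using (Finset.mem_sdiff.1 hj).2)
  have h2 : (Finset.range c \ s).card • u c ≤ ∑ j ∈ Finset.range c \ s, u j :=
    Finset.card_nsmul_le_sum _ _ _ fun j hj =>
      hu (by have := (Finset.mem_sdiff.1 hj).1; simp at this; omega)
  rw [hcard] at h1
  linarith

lemma exists_equiv_of_coe_eq_map {ι : Type*} [Fintype ι] (f : ι → ℝ) {l : List ℝ} {M : ℕ}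
    (hl : (l : Multiset ℝ) = Finset.univ.val.map f) (hM : l.length = M) :
    ∃ e : Fin M ≃ ι, ∀ j : Fin M, l.getD j 0 = f (e j) := by
  subst hM
  have hmap : Finset.univ.val.map l.get = Finset.univ.val.map f := by
    rw [← hl, Fin.univ_val_map, List.ofFn_get]
  have hcard (v : ℝ) : Fintype.card {j // l.get j = v} = Fintype.card {x // f x = v} := by
    have h := congrArg (Multiset.count v) hmap
    rw [Multiset.count_map, Multiset.count_map] at h
    simp only [Fintype.card_subtype, Finset.card_def, Finset.filter_val, eq_comm (b := v)]
    exact h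
  let ε (v : ℝ) := Fintype.equivOfCardEq (hcard v)
  refine ⟨(Equiv.sigmaFiberEquiv l.get).symm.trans
    ((Equiv.sigmaCongrRight ε).trans (Equiv.sigmaFiberEquiv f)), fun j => ?_⟩
  have := (ε (l.get j) ⟨j, rfl⟩).2
  rw [List.getD_eq_getElem _ _ j.2]
  exact this.symm

lemma exists_antitone_enumeration {n k : ℕ} {a : Fin k → ℝ} {p : Fin (2^n) → ℝ}
    (ha : ∀ l, 0 ≤ a l) (hp : ∀ i, 0 ≤ p i) :
    ∃ (u : ℕ → ℝ) (e : Fin (2^n * k) ≃ Fin (2^n) × Fin k), Antitone u ∧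
      (∀ j : Fin (2^n * k), u j = p (e j).1 * a (e j).2) ∧
      ∀ i : Fin (2^n), PPAq n k a p i = ∑ j ∈ Finset.range k, u (i * k + j) := by
  set s := (Finset.univ : Finset (Fin (2^n) × Fin k)).val.map fun x => p x.1 * a x.2 with hs
  set l := (s.sort (· ≤ ·)).reverse with hl
  have hcoe : (l : Multiset ℝ) = s := by
    rw [hl, Multiset.coe_reverse, Multiset.sort_eq]
  have hlen : l.length = 2^n * k := by
    rw [← Multiset.coe_card, hcoe, hs]; simp
  obtain ⟨e, he⟩ := exists_equiv_of_coe_eq_map _ hcoe hlen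
  have hsorted : l.Pairwise (· ≥ ·) := by
    rw [hl, List.pairwise_reverse]
    exact Multiset.pairwise_sort s (· ≤ ·)
  refine ⟨fun j => l.getD j 0, e, fun i j hij => ?_, he, fun i => ?_⟩
  · by_cases hj : j < 2^n * k
    · rcases hij.eq_or_lt with rfl | hij
      · exact le_rfl
      · have := List.pairwise_iff_getElem.1 hsorted i j (by omega) (by omega) hij
        simpa [List.getD_eq_getElem, hlen, hj, hij.trans hj] using this
    · have hj0 : l.getD j 0 = 0 := List.getD_eq_default _ _ (by omega)
      change l.getD j 0 ≤ l.getD i 0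
      rw [hj0]
      by_cases hi : i < 2^n * k
      · rw [he ⟨i, hi⟩]
        exact mul_nonneg (hp _) (ha _)
      · rw [List.getD_eq_default _ _ (by omega)]
  · rw [Finset.sum_range]
    rfl

lemma partialSum_eq_sum_range {N k : ℕ} {q : Fin N → ℝ} {u : ℕ → ℝ}
    (hq : ∀ i : Fin N, q i = ∑ j ∈ Finset.range k, u (i * k + j)) {m : ℕ} (hm : m ≤ N) :
    partialSum q m = ∑ j ∈ Finset.range (m * k), u j := by
  induction m with
  | zero => simp [partialSum]
  | succ m ih =>
    have := partialSum_succ q ⟨m, hm⟩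
    simp only at this
    rw [this, ih (by omega), hq, Nat.succ_mul, Finset.sum_range_add]

/-- The ratio bound makes the columns `p · * a l` of the table of joint probabilities dense enough
that each of them has an entry within a factor `a 0 / a (Fin.last k)` below `v`. -/
lemma exists_lt_of_ratio {N k : ℕ} {a : Fin (k + 1) → ℝ} (ha : Antitone a) (hapos : ∀ l, 0 < a l)
    {p : Fin N → ℝ} (hp : ∀ i, 0 ≤ p i) (hanti : Antitone p)
    (hratio : ∀ i : ℕ, ∀ hi : i + 1 < N,
      a (Fin.last k) * p ⟨i, by omega⟩ ≤ a 0 * p ⟨i + 1, hi⟩)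
    {x y : Fin N × Fin (k + 1)}
    (hxy : a 0 * (p y.1 * a y.2) < a (Fin.last k) * (p x.1 * a x.2)) (l : Fin (k + 1)) :
    ∃ i, p i * a l < p x.1 * a x.2 ∧ a (Fin.last k) * (p x.1 * a x.2) ≤ a 0 * (p i * a l) := by
  have hex : ∃ i : ℕ, ∃ hi : i < N, p ⟨i, hi⟩ * a l < p x.1 * a x.2 := by
    refine ⟨y.1, y.1.2, ?_⟩
    have h1 : a (Fin.last k) * (p y.1 * a l) ≤ a 0 * (p y.1 * a y.2) := by
      have h2 := mul_le_mul (ha (Fin.zero_le l)) (ha (Fin.le_last y.2)) (hapos _).le (hapos 0).le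
      nlinarith [mul_le_mul_of_nonneg_left h2 (hp y.1)]
    exact lt_of_mul_lt_mul_left (h1.trans_lt hxy) (hapos _).le
  classical
  obtain ⟨hi, hlt⟩ := Nat.find_spec hex
  refine ⟨⟨Nat.find hex, hi⟩, hlt, ?_⟩
  generalize hfind : Nat.find hex = i₀ at hi
  rcases i₀ with _ | i
  · have h1 : p x.1 * a x.2 ≤ p ⟨0, by omega⟩ * a 0 :=
      mul_le_mul (hanti (Fin.mk_le_of_le_val (Nat.zero_le _))) (ha (Fin.zero_le _))
        (hapos _).le (hp _)
    have h2 : p ⟨0, by omega⟩ * a (Fin.last k) ≤ p ⟨0, by omega⟩ * a l :=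
      mul_le_mul_of_nonneg_left (ha (Fin.le_last _)) (hp _)
    nlinarith [mul_le_mul_of_nonneg_left h1 (hapos (Fin.last k)).le,
      mul_le_mul_of_nonneg_left h2 (hapos 0).le]
  · have h1 : p x.1 * a x.2 ≤ p ⟨i, by omega⟩ * a l := by
      by_contra! h
      exact Nat.find_min hex (m := i) (by omega) ⟨by omega, h⟩
    nlinarith [mul_le_mul_of_nonneg_left h1 (hapos (Fin.last k)).le,
      mul_le_mul_of_nonneg_right (hratio i hi) (hapos l).le]

lemma enumeration_ratio {N k : ℕ} {a : Fin (k + 1) → ℝ} (ha : Antitone a) (hapos : ∀ l, 0 < a l)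
    {p : Fin N → ℝ} (hp : ∀ i, 0 ≤ p i) (hanti : Antitone p)
    (hratio : ∀ i : ℕ, ∀ hi : i + 1 < N,
      a (Fin.last k) * p ⟨i, by omega⟩ ≤ a 0 * p ⟨i + 1, hi⟩)
    {u : ℕ → ℝ} (hu : Antitone u) (e : Fin (N * (k + 1)) ≃ Fin N × Fin (k + 1))
    (he : ∀ j : Fin (N * (k + 1)), u j = p (e j).1 * a (e j).2) {j : ℕ} (hj : j + (k + 1) < N * (k + 1)) :
    a (Fin.last k) * u j ≤ a 0 * u (j + (k + 1)) := by
  by_contra! hlt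
  have hej := he ⟨j, by omega⟩
  have hej' := he ⟨j + (k + 1), hj⟩
  simp only at hej hej'
  choose g hg using exists_lt_of_ratio ha hapos hp hanti hratio
    (x := e ⟨j, by omega⟩) (y := e ⟨j + (k + 1), hj⟩) (by rwa [← hej, ← hej'])
  simp only [← hej] at hg
  have hval (l) : u (e.symm (g l, l)) = p (g l) * a l := by simp [he]
  let F : Fin (k + 1) → ℕ := fun l => (e.symm (g l, l) : ℕ)
  have hF : Function.Injective F := fun l l' h => by
    have := e.symm.injective (Fin.ext h)
    exact (Prod.ext_iff.1 this).2
  have hsub : Finset.univ.image F ⊆ Finset.Ioo j (j + (k + 1)) := by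
    intro m hm
    obtain ⟨l, -, rfl⟩ := Finset.mem_image.1 hm
    rw [Finset.mem_Ioo]
    constructor
    · by_contra! h
      have := hu h
      rw [hval] at this
      linarith [(hg l).1]
    · by_contra! h
      have := hu h
      rw [hval] at this
      nlinarith [(hg l).2, hapos 0]
  have := Finset.card_le_card hsub
  rw [Finset.card_image_of_injective _ hF, Nat.card_Ioo] at this
  simp at this

lemma sum_le_partialSum {N k : ℕ} {a : Fin k → ℝ} {p q : Fin N → ℝ} {u : ℕ → ℝ} (hu : Antitone u)
    (e : Fin (N * k) ≃ Fin N × Fin k) (he : ∀ j : Fin (N * k), u j = p (e j).1 * a (e j).2)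
    (hq : ∀ i : Fin N, q i = ∑ j ∈ Finset.range k, u (i * k + j)) {m : ℕ} (hm : m ≤ N)
    {s : Finset (Fin N × Fin k)} (hs : s.card = m * k) :
    ∑ x ∈ s, p x.1 * a x.2 ≤ partialSum q m := by
  rw [partialSum_eq_sum_range hq hm, ← hs]
  let φ : Fin N × Fin k ↪ ℕ := e.symm.toEmbedding.trans Fin.valEmbedding
  have := sum_le_sum_range_card hu (s.map φ)
  rw [Finset.card_map, Finset.sum_map] at this
  refine le_trans (le_of_eq (Finset.sum_congr rfl fun x _ => ?_)) this
  simp [φ, he]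

lemma sum_filter_lt_eq_partialSum {N : ℕ} (p : Fin N → ℝ) {m : ℕ} (hm : m ≤ N) :
    ∑ i with i.val < m, p i = partialSum p m := by
  have h : partialSum p m = ∑ i ∈ Finset.range N,
      if i < m then (if h : i < N then p ⟨i, h⟩ else 0) else 0 := by
    rw [← Finset.sum_filter, partialSum]
    congr 1
    ext i
    simp
    omega
  rw [h, Finset.sum_range, Finset.sum_filter]
  simp

lemma sum_rows_eq_partialSum {N k : ℕ} {a : Fin k → ℝ} (hasum : ∑ l, a l = 1) (p : Fin N → ℝ)
    {m : ℕ} (hm : m ≤ N) :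
    ∑ x ∈ (Finset.univ.filter fun i : Fin N => i.val < m) ×ˢ (Finset.univ : Finset (Fin k)),
      p x.1 * a x.2 = partialSum p m := by
  rw [Finset.sum_product, ← sum_filter_lt_eq_partialSum p hm]
  simp [← Finset.mul_sum, hasum]

lemma card_rows {N k m : ℕ} (hm : m ≤ N) :
    ((Finset.univ.filter fun i : Fin N => i.val < m) ×ˢ
      (Finset.univ : Finset (Fin k))).card = m * k := by
  rw [Finset.card_product, Fin.card_filter_val_lt]
  simp [hm]

lemma partialSum_le_PPAq {n k : ℕ} {a : Fin k → ℝ} (hapos : ∀ l, 0 ≤ a l) (hasum : ∑ l, a l = 1)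
    {p : Fin (2^n) → ℝ} (hp : ∀ i, 0 ≤ p i) {m : ℕ} (hm : m ≤ 2^n) :
    partialSum p m ≤ partialSum (PPAq n k a p) m := by
  obtain ⟨u, e, hu, he, hq⟩ := exists_antitone_enumeration hapos hp
  rw [← sum_rows_eq_partialSum hasum p hm]
  exact sum_le_partialSum hu e he hq hm (card_rows hm)

/-- Swapping the smallest entry of row `i` with the largest entry of row `i + 1` bounds the gain of
one iteration from below. -/
lemma partialSum_add_le_PPAq {n k : ℕ} {a : Fin (k + 1) → ℝ} (hapos : ∀ l, 0 ≤ a l)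
    (hasum : ∑ l, a l = 1) {p : Fin (2^n) → ℝ} (hp : ∀ i, 0 ≤ p i) {i : ℕ} (hi : i + 1 < 2^n) :
    partialSum p (i + 1) + (a 0 * p ⟨i + 1, hi⟩ - a (Fin.last k) * p ⟨i, Nat.lt_of_succ_lt hi⟩) ≤
      partialSum (PPAq n (k + 1) a p) (i + 1) := by
  obtain ⟨u, e, hu, he, hq⟩ := exists_antitone_enumeration hapos hp
  rw [← sum_rows_eq_partialSum hasum p hi.le]
  set s := (Finset.univ.filter fun j : Fin (2^n) => j.val < i + 1) ×ˢ
    (Finset.univ : Finset (Fin (k + 1))) with hs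
  have hmem : ((⟨i, Nat.lt_of_succ_lt hi⟩, Fin.last k) : Fin (2^n) × Fin (k + 1)) ∈ s := by simp [hs]
  have hnot : ((⟨i + 1, hi⟩, 0) : Fin (2^n) × Fin (k + 1)) ∉
      s.erase (⟨i, Nat.lt_of_succ_lt hi⟩, Fin.last k) := by simp [hs]
  have hcard : (insert ((⟨i + 1, hi⟩, 0) : Fin (2^n) × Fin (k + 1))
      (s.erase (⟨i, Nat.lt_of_succ_lt hi⟩, Fin.last k))).card = (i + 1) * (k + 1) := by
    rw [Finset.card_insert_of_notMem hnot, Finset.card_erase_add_one hmem, hs, card_rows hi.le]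
  have h := sum_le_partialSum hu e he hq hi.le hcard
  rw [Finset.sum_insert hnot] at h
  have h' := Finset.add_sum_erase s (fun x : Fin (2^n) × Fin (k + 1) => p x.1 * a x.2) hmem
  simp only at h h'
  linarith

lemma isCompState_PPAq {n k : ℕ} {a : Fin (k + 1) → ℝ} (hapos : ∀ l, 0 < a l)
    (hasum : ∑ l, a l = 1) {p : Fin (2^n) → ℝ} (hp : IsCompState n p) :
    IsCompState n (PPAq n (k + 1) a p) := by
  obtain ⟨hpos, -, hsum⟩ := hp
  obtain ⟨u, e, hu, he, hq⟩ :=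
    exists_antitone_enumeration (fun l => (hapos l).le) (fun i => (hpos i).le)
  refine ⟨fun i => ?_, fun i j hij => ?_, ?_⟩
  · rw [hq]
    refine Finset.sum_pos (fun j hj => ?_) (by simp)
    have hlt : i * (k + 1) + j < 2^n * (k + 1) := by
      have := Finset.mem_range.1 hj
      nlinarith [i.2]
    rw [he ⟨_, hlt⟩]
    exact mul_pos (hpos _) (hapos _)
  · rw [hq, hq]
    refine Finset.sum_le_sum fun m _ => hu ?_
    have : i.val ≤ j.val := hij
    gcongr
  · rw [← partialSum_self, partialSum_eq_sum_range hq le_rfl, Finset.sum_range]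
    simp_rw [he]
    rw [Equiv.sum_comp e (fun x => p x.1 * a x.2), Fintype.sum_prod_type]
    simp [← Finset.mul_sum, hasum, hsum]

lemma PPAq_ratio {n k : ℕ} {a : Fin (k + 1) → ℝ} (ha : Antitone a) (hapos : ∀ l, 0 < a l)
    {p : Fin (2^n) → ℝ} (hp : IsCompState n p)
    (hratio : ∀ i : ℕ, ∀ hi : i + 1 < 2^n,
      a (Fin.last k) * p ⟨i, Nat.lt_of_succ_lt hi⟩ ≤ a 0 * p ⟨i + 1, hi⟩) (i : ℕ) (hi : i + 1 < 2^n) :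
    a (Fin.last k) * PPAq n (k + 1) a p ⟨i, Nat.lt_of_succ_lt hi⟩ ≤
      a 0 * PPAq n (k + 1) a p ⟨i + 1, hi⟩ := by
  have hnonneg := fun i => (hp.1 i).le
  obtain ⟨u, e, hu, he, hq⟩ := exists_antitone_enumeration (fun l => (hapos l).le) hnonneg
  rw [hq, hq, Finset.mul_sum, Finset.mul_sum]
  refine Finset.sum_le_sum fun j hj => ?_
  have hjk := Finset.mem_range.1 hj
  have hlt : i * (k + 1) + j + (k + 1) < 2^n * (k + 1) := by nlinarith
  have hidx : (i + 1) * (k + 1) + j = i * (k + 1) + j + (k + 1) := by ring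
  simpa only [hidx] using enumeration_ratio ha hapos hnonneg hp.2.1 hratio hu e he hlt

/-- for PPA with a reset qudit of sorted distribution
`a_1 ≥ ⋯ ≥ a_k > 0`, if the initial ratios satisfy `p⁰_i / p⁰_{i+1} ≤ a_1/a_k`,
then every `p^t_i` converges, and the limits satisfy
`p^∞_{i+1} = (a_k/a_1) p^∞_i`, i.e. `p^∞_i = (a_k/a_1)^i p^∞_0`.
(Here the qudit has `k+1` levels, so `a 0` is `a_1` and `a (Fin.last k)` is `a_k`.) -/
theorem ppaq_asymptotic_state (n k : ℕ) (hn : 1 ≤ n)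
    (a : Fin (k + 1) → ℝ) (ha : Antitone a) (hapos : ∀ l, 0 < a l)
    (hasum : ∑ l, a l = 1)
    (p : ℕ → Fin (2^n) → ℝ) (h0 : IsCompState n (p 0))
    (hstep : ∀ t, p (t + 1) = PPAq n (k + 1) a (p t))
    (hratio : ∀ i : ℕ, ∀ hi : i + 1 < 2^n,
      p 0 ⟨i, by omega⟩ / p 0 ⟨i + 1, hi⟩ ≤ a 0 / a (Fin.last k)) :
    ∃ L : Fin (2^n) → ℝ,
      (∀ i, Tendsto (fun t => p t i) atTop (nhds (L i))) ∧
      (∀ i : ℕ, ∀ hi : i + 1 < 2^n,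
        L ⟨i + 1, hi⟩ = (a (Fin.last k) / a 0) * L ⟨i, by omega⟩) ∧
      (∀ i : Fin (2^n),
        L i = (a (Fin.last k) / a 0) ^ (i : ℕ) * L ⟨0, Nat.two_pow_pos n⟩) := by
  have hstate : ∀ t, IsCompState n (p t) := by
    intro t
    induction t with
    | zero => exact h0
    | succ t ih => rw [hstep]; exact isCompState_PPAq hapos hasum ih
  have hrat : ∀ t, ∀ i : ℕ, ∀ hi : i + 1 < 2^n,
      a (Fin.last k) * p t ⟨i, by omega⟩ ≤ a 0 * p t ⟨i + 1, hi⟩ := by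
    intro t
    induction t with
    | zero =>
      intro i hi
      have := hratio i hi
      rw [div_le_div_iff₀ (h0.1 _) (hapos _)] at this
      linarith
    | succ t ih => rw [hstep]; exact PPAq_ratio ha hapos (hstate t) ih
  have hnonneg : ∀ t i, 0 ≤ p t i := fun t i => ((hstate t).1 i).le
  have hconv : ∀ m ≤ 2^n, ∃ c, Tendsto (fun t => partialSum (p t) m) atTop (nhds c) := by
    intro m hm
    refine ⟨_, tendsto_atTop_ciSup (monotone_nat_of_le_succ fun t => ?_) ⟨1, ?_⟩⟩
    · rw [hstep]
      exact partialSum_le_PPAq (fun l => (hapos l).le) hasum (hnonneg t) hm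
    · rintro _ ⟨t, rfl⟩
      refine (partialSum_mono (hnonneg t) hm).trans ?_
      rw [partialSum_self, (hstate t).2.2]
  choose! c hc using hconv
  let L : Fin (2^n) → ℝ := fun i => c (i + 1) - c i
  have hL : ∀ i, Tendsto (fun t => p t i) atTop (nhds (L i)) := by
    intro i
    refine ((hc (i + 1) i.2).sub (hc i i.2.le)).congr fun t => ?_
    rw [partialSum_succ]
    ring
  have hLratio : ∀ i : ℕ, ∀ hi : i + 1 < 2^n,
      L ⟨i + 1, hi⟩ = (a (Fin.last k) / a 0) * L ⟨i, by omega⟩ := by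
    intro i hi
    have hA := (hL ⟨i + 1, hi⟩).const_mul (a 0)
    have hB := (hL ⟨i, by omega⟩).const_mul (a (Fin.last k))
    have hge := le_of_tendsto_of_tendsto' hB hA fun t => hrat t i hi
    have hle := le_of_tendsto_of_tendsto' ((hc (i + 1) hi.le).add (hA.sub hB))
      ((hc (i + 1) hi.le).comp (tendsto_add_atTop_nat 1)) fun t => by
        simp only [Function.comp_apply, hstep]
        exact partialSum_add_le_PPAq (fun l => (hapos l).le) hasum (hnonneg t) hi
    have := hapos 0
    field_simp
    linarith
  refine ⟨L, hL, hLratio, ?_⟩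
  rintro ⟨i, hi⟩
  induction i with
  | zero => simp
  | succ i ih =>
    rw [hLratio i hi, ih (by omega), pow_succ]
    ring
end
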